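/- arXiv:1303.0735 — 2 statements merged into one kernel-verified Lean document; each statement's English description precedes it below -/
import Mathlib

section
/- Let m_1,…,m_n be a minimal generating set of a monomial ideal I of R and let 1 ≤ i < j ≤ n. If gcd(m_i, m_j) = 1 and there is no index k with k ≠ i, k ≠ j such that m_k strictly divides m_{ij} = m_i·m_j, then σ_{ij} = m_i·e_j − m_j·e_i and σ_{ij} ∉ 𝔪Z₂. -/
open MvPolynomial

noncomputable section

/-- The trivariate polynomial ring `K[x,y,z]`, with variables indexed by `Fin 3`. -/
abbrev PR (K : Type*) [Field K] : Type _ := MvPolynomial (Fin 3) K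

/-- The monomial of `K[x,y,z]` with exponent vector `a : Fin 3 → ℕ`. -/
noncomputable def monom (K : Type*) [Field K] (a : Fin 3 → ℕ) : PR K :=
  ∏ t, X t ^ a t

/-- `m 0, …, m (n-1)` (given by their exponent vectors) form a minimal generating set of the
monomial ideal they generate: they are pairwise distinct and no one divides another.
(Divisibility of monomials is pointwise `≤` of exponent vectors, so non-divisibility for all
pairs of distinct indices already implies distinctness.) -/
def MinGen {n : ℕ} (m : Fin n → Fin 3 → ℕ) : Prop :=
  ∀ i j, i ≠ j → ¬ m i ≤ m j

/-- Strict divisibility of monomials, in terms of exponent vectors: `a` divides `b` and `a ≠ b`. -/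
def strictDvd (a b : Fin 3 → ℕ) : Prop := a ≤ b ∧ a ≠ b

/-- Strong divisibility of monomials: `a` divides `b / x_t` for every variable `x_t`
dividing `b`. -/
def strongDvd (a b : Fin 3 → ℕ) : Prop :=
  ∀ t, 0 < b t → a ≤ b - Pi.single t 1

/-- A monomial ideal (given by the exponent vectors of its minimal generators) is generic if
whenever two distinct minimal generators have the same positive exponent in some variable,
a third minimal generator strongly divides their lcm. -/
def GenericI {n : ℕ} (m : Fin n → Fin 3 → ℕ) : Prop :=
  ∀ i j, i ≠ j → (∃ t, 0 < m i t ∧ m i t = m j t) →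
    ∃ l, l ≠ i ∧ l ≠ j ∧ strongDvd (m l) (m i ⊔ m j)

/-- The homogeneous maximal ideal `𝔪 = (x,y,z)` of `K[x,y,z]`. -/
noncomputable def mxIdeal (K : Type*) [Field K] : Ideal (PR K) :=
  Ideal.span (Set.range X)

/-- The `R`-linear map `f₁ : Rⁿ → R` sending the `i`-th standard basis vector to the
monomial `m_i`. -/
noncomputable def syzF1 (K : Type*) [Field K] {n : ℕ} (m : Fin n → Fin 3 → ℕ) :
    (Fin n → PR K) →ₗ[PR K] PR K where
  toFun v := ∑ i, v i * monom K (m i)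
  map_add' u v := by simp [add_mul, Finset.sum_add_distrib]
  map_smul' c v := by simp [Finset.mul_sum, mul_assoc]

/-- The module `Z₂ = ker f₁` of second syzygies of `R/I`. -/
noncomputable def Z2 (K : Type*) [Field K] {n : ℕ} (m : Fin n → Fin 3 → ℕ) :
    Submodule (PR K) (Fin n → PR K) :=
  LinearMap.ker (syzF1 K m)

/-- The S-pair `σ_{ij} = (m_{ij}/m_j)·e_j − (m_{ij}/m_i)·e_i ∈ Rⁿ`. -/
noncomputable def sigmaS (K : Type*) [Field K] {n : ℕ} (m : Fin n → Fin 3 → ℕ)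
    (i j : Fin n) : Fin n → PR K :=
  Pi.single j (monom K ((m i ⊔ m j) - m j)) - Pi.single i (monom K ((m i ⊔ m j) - m i))

/-- `τ_{ijl} = (m_{ijl}/m_{ij})·e_{ij} − (m_{ijl}/m_{il})·e_{il} + (m_{ijl}/m_{jl})·e_{jl}`,
an element of the free module `F₂` with basis `e_{pq}` indexed by pairs. -/
noncomputable def tauS (K : Type*) [Field K] {n : ℕ} (m : Fin n → Fin 3 → ℕ)
    (i j l : Fin n) : Fin n × Fin n → PR K :=
  Pi.single (i, j) (monom K ((m i ⊔ m j ⊔ m l) - (m i ⊔ m j)))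
    - Pi.single (i, l) (monom K ((m i ⊔ m j ⊔ m l) - (m i ⊔ m l)))
    + Pi.single (j, l) (monom K ((m i ⊔ m j ⊔ m l) - (m j ⊔ m l)))

/-- The submodule `Z₃` of `F₂` generated by all `τ_{abc}` with `a < b < c`. -/
noncomputable def Z3 (K : Type*) [Field K] {n : ℕ} (m : Fin n → Fin 3 → ℕ) :
    Submodule (PR K) (Fin n × Fin n → PR K) :=
  Submodule.span (PR K) {v | ∃ a b c : Fin n, a < b ∧ b < c ∧ v = tauS K m a b c}

theorem monom_eq_monomial (K : Type*) [Field K] (a : Fin 3 → ℕ) :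
    monom K a = monomial (Finsupp.equivFunOnFinite.symm a) 1 := by
  rw [monom, monomial_eq, Finsupp.prod_fintype _ _ (fun _ => pow_zero _)]
  simp

/-- If no generator other than `m j` divides the monomial with exponent `d + m j`, then the
`j`-th entry of a syzygy has no term with exponent `d`. -/
theorem coeff_eq_zero_of_mem_Z2 {K : Type*} [Field K] {n : ℕ} {m : Fin n → Fin 3 → ℕ}
    {z : Fin n → PR K} (hz : z ∈ Z2 K m) {j : Fin n} {d : Fin 3 →₀ ℕ}
    (h : ∀ l, l ≠ j → ¬ m l ≤ ⇑d + m j) : coeff d (z j) = 0 := by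
  have hsum : ∑ l, z l * monom K (m l) = 0 := hz
  have hc := congrArg (coeff (d + Finsupp.equivFunOnFinite.symm (m j))) hsum
  rw [coeff_sum, Finset.sum_eq_single j, monom_eq_monomial, coeff_mul_monomial] at hc
  · simpa using hc
  · intro l _ hl
    rw [monom_eq_monomial, coeff_mul_monomial', if_neg]
    exact fun hle => h l hl fun t => by simpa using hle t
  · simp

/-- The `j`-th entry of an element of `𝔪N` has no term with exponent `d` if no `j`-th entry of an
element of `N` has a term whose exponent is that of `d` divided by a variable. -/
theorem coeff_eq_zero_of_mem_mxIdeal_smul {K : Type*} [Field K] {n : ℕ}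
    {N : Submodule (PR K) (Fin n → PR K)} {j : Fin n} {d : Fin 3 →₀ ℕ}
    (h : ∀ z ∈ N, ∀ t, d t ≠ 0 → coeff (d - Finsupp.single t 1) (z j) = 0)
    {v : Fin n → PR K} (hv : v ∈ mxIdeal K • N) : coeff d (v j) = 0 := by
  induction hv using Submodule.smul_induction_on' with
  | smul r hr z hz =>
    induction hr using Submodule.span_induction generalizing z with
    | mem r hr =>
      obtain ⟨t, rfl⟩ := hr
      rw [Pi.smul_apply, smul_eq_mul, coeff_X_mul']
      split_ifs with ht
      · exact h z hz t (Finsupp.mem_support_iff.mp ht)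
      · rfl
    | zero => simp
    | add r s _ _ hr hs => rw [add_smul, Pi.add_apply, coeff_add, hr z hz, hs z hz, add_zero]
    | smul a r _ hr =>
      rw [smul_eq_mul, mul_comm, mul_smul]
      exact hr (a • z) (N.smul_mem a hz)
  | add u _ w _ hu hw => simp [hu, hw]

/-- If `gcd(m_i, m_j) = 1` and no minimal generator `m_l` (`l ≠ i, j`)
strictly divides `m_{ij} = m_i·m_j`, then `σ_{ij} = m_i·e_j − m_j·e_i` and
`σ_{ij} ∉ 𝔪Z₂`. -/
theorem stmt6 (K : Type*) [Field K] {n : ℕ} (m : Fin n → Fin 3 → ℕ) (hm : MinGen m)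
    (i j : Fin n) (hij : i < j)
    (hgcd : m i ⊓ m j = 0)
    (h : ¬ ∃ l, l ≠ i ∧ l ≠ j ∧ strictDvd (m l) (m i ⊔ m j)) :
    sigmaS K m i j = Pi.single j (monom K (m i)) - Pi.single i (monom K (m j)) ∧
      sigmaS K m i j ∉ mxIdeal K • Z2 K m := by
  have hdisj : ∀ t, m i t = 0 ∨ m j t = 0 := fun t => by
    have := congrFun hgcd t
    simp only [Pi.inf_apply, Pi.zero_apply] at this
    omega
  have hi : (m i ⊔ m j) - m j = m i := by
    ext t
    have := hdisj t
    simp only [Pi.sub_apply, Pi.sup_apply]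
    omega
  have hj : (m i ⊔ m j) - m i = m j := by
    ext t
    have := hdisj t
    simp only [Pi.sub_apply, Pi.sup_apply]
    omega
  have hdvd : ∀ l, l ≠ i → l ≠ j → ¬ m l ≤ m i ⊔ m j := fun l hli hlj hle =>
    h ⟨l, hli, hlj, hle, fun heq => hm i l hli.symm (heq ▸ le_sup_left)⟩
  have hσ : sigmaS K m i j = Pi.single j (monom K (m i)) - Pi.single i (monom K (m j)) := by
    rw [sigmaS, hi, hj]
  refine ⟨hσ, fun hmem => ?_⟩
  have hzero : coeff (Finsupp.equivFunOnFinite.symm (m i)) (sigmaS K m i j j) = 0 := by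
    refine coeff_eq_zero_of_mem_mxIdeal_smul (fun z hz t ht => ?_) hmem
    replace ht : m i t ≠ 0 := ht
    refine coeff_eq_zero_of_mem_Z2 hz fun l hlj hle => ?_
    by_cases hli : l = i
    · subst hli
      have hlt := hle t
      have := hdisj t
      simp only [Pi.add_apply, Finsupp.tsub_apply, Finsupp.equivFunOnFinite_symm_apply_apply,
        Finsupp.single_eq_same] at hlt
      omega
    · refine hdvd l hli hlj fun s => (hle s).trans ?_
      have := hdisj s
      simp only [Pi.add_apply, Finsupp.tsub_apply, Finsupp.equivFunOnFinite_symm_apply_apply,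
        Pi.sup_apply]
      omega
  rw [hσ, Pi.sub_apply, Pi.single_eq_same, Pi.single_eq_of_ne hij.ne', sub_zero,
    monom_eq_monomial, coeff_monomial, if_pos rfl] at hzero
  exact one_ne_zero hzero
end
end

section
/- Let m_1,…,m_n (n ≥ 4) be a minimal generating set of a monomial ideal I of R with m_1 = x^a, m_2 = y^b, m_3 = z^c (a,b,c > 0) and m_4 = x^{α}y^{β}z^{γ} where α < a, β < b and γ < c. Then m_{124}, m_{134} and m_{234} all strictly divide m_{123} = x^a y^b z^c, and consequently τ_{123} ∈ 𝔪Z₃. -/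
open MvPolynomial

noncomputable section

theorem monom_add (K : Type*) [Field K] (u v : Fin 3 → ℕ) :
    monom K (u + v) = monom K u * monom K v := by
  simp [monom, pow_add, Finset.prod_mul_distrib]

theorem monom_sub_mul_monom_sub (K : Type*) [Field K] {u v w : Fin 3 → ℕ} (huv : u ≤ v)
    (hvw : v ≤ w) : monom K (w - v) * monom K (v - u) = monom K (w - u) := by
  rw [← monom_add, tsub_add_tsub_cancel hvw huv]

theorem monom_sub_mem_mxIdeal (K : Type*) [Field K] {u v : Fin 3 → ℕ} (h : strictDvd u v) :
    monom K (v - u) ∈ mxIdeal K := by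
  obtain ⟨hle, hne⟩ := h
  obtain ⟨t, ht⟩ : ∃ t, u t < v t := (Pi.lt_def.1 (lt_of_le_of_ne hle hne)).2
  have hX : (X t : PR K) ∣ monom K (v - u) :=
    (dvd_pow_self _ (Nat.sub_pos_of_lt ht).ne').trans
      (Finset.dvd_prod_of_mem (fun s => (X s : PR K) ^ (v - u) s) (Finset.mem_univ t))
  exact Ideal.mem_of_dvd _ hX (Ideal.subset_span ⟨t, rfl⟩)

/-- A monomial multiple of `τ_{ijl}`, expanded in the basis `e_{pq}`. -/
theorem monom_sub_smul_tauS (K : Type*) [Field K] {n : ℕ} (m : Fin n → Fin 3 → ℕ)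
    (i j l : Fin n) {w : Fin 3 → ℕ} (hw : m i ⊔ m j ⊔ m l ≤ w) :
    monom K (w - (m i ⊔ m j ⊔ m l)) • tauS K m i j l =
      Pi.single (i, j) (monom K (w - (m i ⊔ m j)))
        - Pi.single (i, l) (monom K (w - (m i ⊔ m l)))
        + Pi.single (j, l) (monom K (w - (m j ⊔ m l))) := by
  have hij : m i ⊔ m j ≤ m i ⊔ m j ⊔ m l := le_sup_left
  have hil : m i ⊔ m l ≤ m i ⊔ m j ⊔ m l := sup_le_sup_right le_sup_left _
  have hjl : m j ⊔ m l ≤ m i ⊔ m j ⊔ m l := sup_le_sup_right le_sup_right _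
  simp only [tauS, smul_add, smul_sub, ← Pi.single_smul', smul_eq_mul,
    monom_sub_mul_monom_sub K hij hw, monom_sub_mul_monom_sub K hil hw,
    monom_sub_mul_monom_sub K hjl hw]

/-- The boundary relation among the four faces of a tetrahedron `i j l p` in the Taylor complex,
when `m_p` divides `m_{ijl}`. -/
theorem tauS_eq_of_lcm_le (K : Type*) [Field K] {n : ℕ} (m : Fin n → Fin 3 → ℕ)
    (i j l p : Fin n) (hij : m i ⊔ m j ⊔ m p ≤ m i ⊔ m j ⊔ m l)
    (hil : m i ⊔ m l ⊔ m p ≤ m i ⊔ m j ⊔ m l) (hjl : m j ⊔ m l ⊔ m p ≤ m i ⊔ m j ⊔ m l) :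
    tauS K m i j l =
      monom K ((m i ⊔ m j ⊔ m l) - (m i ⊔ m j ⊔ m p)) • tauS K m i j p
        - monom K ((m i ⊔ m j ⊔ m l) - (m i ⊔ m l ⊔ m p)) • tauS K m i l p
        + monom K ((m i ⊔ m j ⊔ m l) - (m j ⊔ m l ⊔ m p)) • tauS K m j l p := by
  rw [monom_sub_smul_tauS K m i j p hij, monom_sub_smul_tauS K m i l p hil,
    monom_sub_smul_tauS K m j l p hjl, tauS]
  abel

theorem tauS_mem_mxIdeal_smul_Z3 (K : Type*) [Field K] {n : ℕ} (m : Fin n → Fin 3 → ℕ)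
    {i j l p : Fin n} (h₁ : i < j) (h₂ : j < l) (h₃ : l < p)
    (hij : strictDvd (m i ⊔ m j ⊔ m p) (m i ⊔ m j ⊔ m l))
    (hil : strictDvd (m i ⊔ m l ⊔ m p) (m i ⊔ m j ⊔ m l))
    (hjl : strictDvd (m j ⊔ m l ⊔ m p) (m i ⊔ m j ⊔ m l)) :
    tauS K m i j l ∈ mxIdeal K • Z3 K m := by
  have hmem : ∀ {q r s : Fin n}, q < r → r < s → tauS K m q r s ∈ Z3 K m :=
    fun hqr hrs => Submodule.subset_span ⟨_, _, _, hqr, hrs, rfl⟩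
  rw [tauS_eq_of_lcm_le K m i j l p hij.1 hil.1 hjl.1]
  exact add_mem (sub_mem
    (Submodule.smul_mem_smul (monom_sub_mem_mxIdeal K hij) (hmem h₁ (h₂.trans h₃)))
    (Submodule.smul_mem_smul (monom_sub_mem_mxIdeal K hil) (hmem (h₁.trans h₂) h₃)))
    (Submodule.smul_mem_smul (monom_sub_mem_mxIdeal K hjl) (hmem h₂ h₃))

/-- If the first four minimal generators are `m_1 = x^a`, `m_2 = y^b`,
`m_3 = z^c` and `m_4 = x^α y^β z^γ` with `α < a`, `β < b`, `γ < c`, then `m_{124}`,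
`m_{134}` and `m_{234}` all strictly divide `m_{123} = x^a y^b z^c`, and consequently
`τ_{123} ∈ 𝔪Z₃`. -/
theorem stmt14 (K : Type*) [Field K] {n : ℕ} (hn : 4 ≤ n)
    (m : Fin n → Fin 3 → ℕ) (hm : MinGen m)
    (a b c α β γ : ℕ) (ha : 0 < a) (hb : 0 < b) (hc : 0 < c)
    (hα : α < a) (hβ : β < b) (hγ : γ < c)
    (h1 : m ⟨0, by omega⟩ = ![a, 0, 0]) (h2 : m ⟨1, by omega⟩ = ![0, b, 0])
    (h3 : m ⟨2, by omega⟩ = ![0, 0, c]) (h4 : m ⟨3, by omega⟩ = ![α, β, γ]) :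
    strictDvd (m ⟨0, by omega⟩ ⊔ m ⟨1, by omega⟩ ⊔ m ⟨3, by omega⟩)
        (m ⟨0, by omega⟩ ⊔ m ⟨1, by omega⟩ ⊔ m ⟨2, by omega⟩) ∧
      strictDvd (m ⟨0, by omega⟩ ⊔ m ⟨2, by omega⟩ ⊔ m ⟨3, by omega⟩)
        (m ⟨0, by omega⟩ ⊔ m ⟨1, by omega⟩ ⊔ m ⟨2, by omega⟩) ∧
      strictDvd (m ⟨1, by omega⟩ ⊔ m ⟨2, by omega⟩ ⊔ m ⟨3, by omega⟩)
        (m ⟨0, by omega⟩ ⊔ m ⟨1, by omega⟩ ⊔ m ⟨2, by omega⟩) ∧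
      m ⟨0, by omega⟩ ⊔ m ⟨1, by omega⟩ ⊔ m ⟨2, by omega⟩ = ![a, b, c] ∧
      tauS K m ⟨0, by omega⟩ ⟨1, by omega⟩ ⟨2, by omega⟩ ∈ mxIdeal K • Z3 K m := by
  have h124 : strictDvd (m ⟨0, by omega⟩ ⊔ m ⟨1, by omega⟩ ⊔ m ⟨3, by omega⟩)
      (m ⟨0, by omega⟩ ⊔ m ⟨1, by omega⟩ ⊔ m ⟨2, by omega⟩) := by
    rw [h1, h2, h3, h4]
    refine ⟨fun t => ?_, fun h => ?_⟩
    · fin_cases t <;> simp <;> omega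
    · have := congrFun h 2
      simp at this
      omega
  have h134 : strictDvd (m ⟨0, by omega⟩ ⊔ m ⟨2, by omega⟩ ⊔ m ⟨3, by omega⟩)
      (m ⟨0, by omega⟩ ⊔ m ⟨1, by omega⟩ ⊔ m ⟨2, by omega⟩) := by
    rw [h1, h2, h3, h4]
    refine ⟨fun t => ?_, fun h => ?_⟩
    · fin_cases t <;> simp <;> omega
    · have := congrFun h 1
      simp at this
      omega
  have h234 : strictDvd (m ⟨1, by omega⟩ ⊔ m ⟨2, by omega⟩ ⊔ m ⟨3, by omega⟩)
      (m ⟨0, by omega⟩ ⊔ m ⟨1, by omega⟩ ⊔ m ⟨2, by omega⟩) := by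
    rw [h1, h2, h3, h4]
    refine ⟨fun t => ?_, fun h => ?_⟩
    · fin_cases t <;> simp <;> omega
    · have := congrFun h 0
      simp at this
      omega
  refine ⟨h124, h134, h234, ?_, tauS_mem_mxIdeal_smul_Z3 K m (p := ⟨3, by omega⟩)
    (by simp) (by simp) (by simp) h124 h134 h234⟩
  rw [h1, h2, h3]
  ext t
  fin_cases t <;> simp
end
end
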